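/- arXiv:2603.17819 — 2 statements merged into one kernel-verified Lean document; each statement's English description precedes it below -/
import Mathlib

section
/- Let p ≥ 1 and for each i ∈ {0,…,p−1} let 𝐚_i = a_{i,1}a_{i,2}⋯ be a sequence of nonnegative integers that is eventually zero, lexicographically greater than 10^ω, and satisfies a_{i,j+1}a_{i,j+2}⋯ <_lex 𝐚_{(i−j) mod p} for all j ≥ 1. Then there exists a unique alternate base B = (β_{p−1},…,β_0) of length p such that for every i ∈ {0,…,p−1}, 𝐚_i is the greedy S^i(B)-expansion of 1. -/
/-- `valS B n a = val_{S^n(B)}(0 · a)`, where `a j` is the `(j+1)`-st digit. -/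
noncomputable def valS (B : ℤ → ℝ) (n : ℤ) (a : ℕ → ℕ) : ℝ :=
  ∑' j : ℕ, (a j : ℝ) / ∏ i ∈ Finset.range (j + 1), B (n - 1 - i)

/-- Strict lexicographic order on one-sided digit sequences. -/
def lexLt (x y : ℕ → ℕ) : Prop := ∃ j, (∀ i < j, x i = y i) ∧ x j < y j

def lexLe (x y : ℕ → ℕ) : Prop := x = y ∨ lexLt x y

/-- The sequence ends in a tail of zeros. -/
def EvZero (x : ℕ → ℕ) : Prop := ∃ N, ∀ j ≥ N, x j = 0

/-- `t` is the greedy `S^n(B)`-expansion of `1`: it is lexicographically greatest among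
sequences of nonnegative integers with value `1`. -/
def IsGreedyOne (B : ℤ → ℝ) (n : ℤ) (t : ℕ → ℕ) : Prop :=
  valS B n t = 1 ∧ ∀ b : ℕ → ℕ, valS B n b = 1 → lexLe b t

/-- `d` is the quasi-greedy `S^n(B)`-expansion of `1`: it is lexicographically greatest among
sequences of nonnegative integers not ending in a tail of zeros with value `1`. -/
def IsQuasiGreedyOne (B : ℤ → ℝ) (n : ℤ) (d : ℕ → ℕ) : Prop :=
  ¬ EvZero d ∧ valS B n d = 1 ∧
    ∀ b : ℕ → ℕ, ¬ EvZero b → valS B n b = 1 → lexLe b d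

/-- The sequence `1 0 0 0 ⋯`. -/
def tenOmega : ℕ → ℕ := fun j => if j = 0 then 1 else 0

open Filter Topology

section Contraction

variable {P : ℕ} {r : ℕ → ℝ} {δ : ℝ}

/-- Each term is bounded by the extreme values of the `P` preceding ones, with a definite pull
towards the immediate predecessor. -/
def PullsBack (P : ℕ) (δ : ℝ) (r : ℕ → ℝ) : Prop :=
  ∀ n m M, (∀ k < P, m ≤ r (n + k) ∧ r (n + k) ≤ M) →
    m + δ * (r (n + P - 1) - m) ≤ r (n + P) ∧ r (n + P) ≤ M - δ * (M - r (n + P - 1))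

theorem PullsBack.bounds_persist (hP : 0 < P) (hδ0 : 0 < δ) (h : PullsBack P δ r) {n : ℕ} {m M : ℝ}
    (hb : ∀ k < P, m ≤ r (n + k) ∧ r (n + k) ≤ M) (k : ℕ) :
    m ≤ r (n + k) ∧ r (n + k) ≤ M := by
  induction k using Nat.strong_induction_on with
  | _ k ih =>
    by_cases hk : k < P
    · exact hb k hk
    · have h1 := h (n + (k - P)) m M (fun l hl => by
        have := ih (k - P + l) (by omega)
        rwa [← add_assoc] at this)
      have h2 := ih (k - 1) (by omega)
      rw [show n + (k - P) + P - 1 = n + (k - 1) by omega,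
        show n + (k - P) + P = n + k by omega] at h1
      have h3 := mul_nonneg hδ0.le (sub_nonneg.2 h2.1)
      have h4 := mul_nonneg hδ0.le (sub_nonneg.2 h2.2)
      constructor <;> linarith

theorem PullsBack.contract (hP : 0 < P) (hδ0 : 0 < δ) (hδ1 : δ ≤ 1) (h : PullsBack P δ r)
    {n₀ : ℕ} {m M : ℝ} (hb : ∀ n ≥ n₀, m ≤ r n ∧ r n ≤ M) :
    ∃ m' M', M' - m' ≤ (1 - δ ^ P) * (M - m) ∧
      ∀ n ≥ n₀ + P, m' ≤ r n ∧ r n ≤ M' := by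
  set s := r (n₀ + P - 1) with hs
  have hsb := hb (n₀ + P - 1) (by omega)
  rw [← hs] at hsb
  have key : ∀ k, m + δ ^ k * (s - m) ≤ r (n₀ + P - 1 + k) ∧
      r (n₀ + P - 1 + k) ≤ M - δ ^ k * (M - s) := by
    intro k
    induction k with
    | zero => simp [hs]
    | succ k ih =>
      have h1 := h (n₀ + k) m M (fun l _ => hb _ (by omega))
      rw [show n₀ + k + P - 1 = n₀ + P - 1 + k by omega,
        show n₀ + k + P = n₀ + P - 1 + (k + 1) by omega] at h1
      have h2 := mul_le_mul_of_nonneg_left ih.1 hδ0.le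
      have h3 := mul_le_mul_of_nonneg_left ih.2 hδ0.le
      rw [pow_succ]
      constructor <;> linarith
  refine ⟨m + δ ^ P * (s - m), M - δ ^ P * (M - s), ?_, ?_⟩
  · linarith
  · intro n hn
    obtain ⟨k, rfl⟩ := Nat.exists_eq_add_of_le hn
    refine h.bounds_persist hP hδ0 (fun k hk => ?_) k
    have h1 := key (k + 1)
    rw [show n₀ + P - 1 + (k + 1) = n₀ + P + k by omega] at h1
    have h2 : δ ^ P ≤ δ ^ (k + 1) := pow_le_pow_of_le_one hδ0.le hδ1 (by omega)
    have h3 := mul_le_mul_of_nonneg_right h2 (sub_nonneg.2 hsb.1)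
    have h4 := mul_le_mul_of_nonneg_right h2 (sub_nonneg.2 hsb.2)
    constructor <;> linarith

theorem PullsBack.geometric (hP : 0 < P) (hδ0 : 0 < δ) (hδ1 : δ ≤ 1) (h : PullsBack P δ r)
    (hr : ∀ n, 0 < r n) :
    ∃ A ρ m : ℝ, 0 ≤ ρ ∧ ρ < 1 ∧ 0 < m ∧ (∀ n, m ≤ r n) ∧
      ∀ k n n', k * P ≤ n → k * P ≤ n' → |r n - r n'| ≤ A * ρ ^ k := by
  have hne : (Finset.range P).Nonempty := ⟨0, by simpa using hP⟩
  obtain ⟨x, -, hx⟩ := Finset.exists_min_image (Finset.range P) r hne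
  obtain ⟨y, -, hy⟩ := Finset.exists_max_image (Finset.range P) r hne
  have h0 : ∀ n, r x ≤ r n ∧ r n ≤ r y := by
    intro n
    have := h.bounds_persist hP hδ0 (n := 0) (m := r x) (M := r y) (fun k hk => by
      rw [zero_add]
      exact ⟨hx k (by simpa using hk), hy k (by simpa using hk)⟩) n
    simpa using this
  have hρ : 0 ≤ 1 - δ ^ P := by linarith [pow_le_one₀ (n := P) hδ0.le hδ1]
  have hit : ∀ k, ∃ m M, M - m ≤ (r y - r x) * (1 - δ ^ P) ^ k ∧
      ∀ n ≥ k * P, m ≤ r n ∧ r n ≤ M := by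
    intro k
    induction k with
    | zero => exact ⟨r x, r y, by simp, fun n _ => h0 n⟩
    | succ k ih =>
      obtain ⟨m, M, h1, h2⟩ := ih
      obtain ⟨m', M', h3, h4⟩ := h.contract hP hδ0 hδ1 h2
      refine ⟨m', M', h3.trans ?_, fun n hn => h4 n (by rw [add_mul, one_mul] at hn; exact hn)⟩
      have := mul_le_mul_of_nonneg_left h1 hρ
      rw [pow_succ]
      linarith
  refine ⟨r y - r x, 1 - δ ^ P, r x, hρ, by linarith [pow_pos hδ0 P], hr x,
    fun n => (h0 n).1, fun k n n' hn hn' => ?_⟩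
  obtain ⟨m, M, h1, h2⟩ := hit k
  rw [abs_le]
  have := h2 n hn
  have := h2 n' hn'
  constructor <;> linarith

end Contraction

section Recurrence

variable {P : ℕ} {c : ℕ → ℕ → ℝ} {C : ℝ}

/-- `u` solves the linear recurrence of order `P` with coefficients `c`. -/
def Solves (P : ℕ) (c : ℕ → ℕ → ℝ) (u : ℕ → ℝ) : Prop :=
  ∀ n, u (n + P) = ∑ j ∈ Finset.range P, c n j * u (n + P - 1 - j)

theorem Solves.step_le {w : ℕ → ℝ} (hc : ∀ n j, 0 ≤ c n j)
    (hC : ∀ n, ∑ j ∈ Finset.range P, c n j ≤ C) (hw : ∀ n, 0 < w n) (hmono : Monotone w)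
    (hwr : Solves P c w) (n : ℕ) : w (n + P) ≤ C * w (n + P - 1) := by
  rw [hwr n]
  calc ∑ j ∈ Finset.range P, c n j * w (n + P - 1 - j)
      ≤ ∑ j ∈ Finset.range P, c n j * w (n + P - 1) :=
        Finset.sum_le_sum fun j _ =>
          mul_le_mul_of_nonneg_left (hmono (Nat.sub_le _ _)) (hc n j)
    _ = (∑ j ∈ Finset.range P, c n j) * w (n + P - 1) := by rw [Finset.sum_mul]
    _ ≤ _ := mul_le_mul_of_nonneg_right (hC n) (hw _).le

theorem Solves.pred_le (hP : 0 < P) {u : ℕ → ℝ} (hc : ∀ n j, 0 ≤ c n j) (hc0 : ∀ n, 1 ≤ c n 0)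
    (hur : Solves P c u) {n : ℕ} (hu : ∀ k < P, 0 ≤ u (n + k)) : u (n + P - 1) ≤ u (n + P) := by
  rw [hur n]
  have hnn : ∀ j ∈ Finset.range P, 0 ≤ c n j * u (n + P - 1 - j) := fun j hj => by
    have hj' := Finset.mem_range.1 hj
    have := hu (P - 1 - j) (by omega)
    rw [show n + (P - 1 - j) = n + P - 1 - j by omega] at this
    exact mul_nonneg (hc n j) this
  have h1 := Finset.single_le_sum hnn (Finset.mem_range.2 hP)
  have h2 := hu (P - 1) (by omega)
  rw [show n + (P - 1) = n + P - 1 by omega] at h2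
  have h3 := mul_le_mul_of_nonneg_right (hc0 n) h2
  simp only [Nat.sub_zero, one_mul] at h1 h3
  exact h3.trans h1

theorem Solves.linear {u v : ℕ → ℝ} (hu : Solves P c u) (hv : Solves P c v) (s t : ℝ) :
    Solves P c (fun n => s * u n + t * v n) := by
  intro n
  simp only [hu n, hv n, Finset.mul_sum, ← Finset.sum_add_distrib]
  exact Finset.sum_congr rfl fun j _ => by ring

theorem Solves.ratio_geometric (hP : 0 < P) (hc : ∀ n j, 0 ≤ c n j) (hc0 : ∀ n, 1 ≤ c n 0)
    (hC : ∀ n, ∑ j ∈ Finset.range P, c n j ≤ C) {v w : ℕ → ℝ} (hv : ∀ n, 0 < v n)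
    (hw : ∀ n, 0 < w n) (hmono : Monotone w) (hvr : Solves P c v) (hwr : Solves P c w) :
    ∃ A ρ m : ℝ, 0 ≤ ρ ∧ ρ < 1 ∧ 0 < m ∧ (∀ n, m ≤ v n / w n) ∧
      ∀ k n n', k * P ≤ n → k * P ≤ n' → |v n / w n - v n' / w n'| ≤ A * ρ ^ k := by
  have hC1 : 1 ≤ C := (hc0 0).trans
    ((Finset.single_le_sum (fun j _ => hc 0 j) (Finset.mem_range.2 hP)).trans (hC 0))
  have hC0 : 0 < C := by linarith
  refine PullsBack.geometric (r := fun n => v n / w n) (δ := C⁻¹) hP (inv_pos.2 hC0)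
    (inv_le_one_of_one_le₀ hC1) ?_ fun n => div_pos (hv n) (hw n)
  intro n m M hb
  have hstep := hwr.step_le hc hC hw hmono n
  have hwn := hw (n + P)
  have hwp := hw (n + P - 1)
  have hδ : C⁻¹ ≤ w (n + P - 1) / w (n + P) := by
    rw [le_div_iff₀ hwn, inv_mul_le_iff₀ hC0]
    exact hstep
  have h1 := (hvr.linear hwr 1 (-m)).pred_le hP hc hc0 (n := n) (fun k hk => by
    have := (le_div_iff₀ (hw _)).1 (hb k hk).1
    linarith)
  have h2 := (hvr.linear hwr (-1) M).pred_le hP hc hc0 (n := n) (fun k hk => by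
    have := (div_le_iff₀ (hw _)).1 (hb k hk).2
    linarith)
  have h3 := hb (P - 1) (by omega)
  rw [show n + (P - 1) = n + P - 1 by omega] at h3
  have e : v (n + P - 1) / w (n + P - 1) * (w (n + P - 1) / w (n + P)) =
      v (n + P - 1) / w (n + P) := by field_simp
  have h4 := mul_le_mul_of_nonneg_right hδ (sub_nonneg.2 h3.1)
  have h5 := mul_le_mul_of_nonneg_right hδ (sub_nonneg.2 h3.2)
  have h6 := div_le_div_of_nonneg_right h1 hwn.le
  have h7 := div_le_div_of_nonneg_right h2 hwn.le
  simp only [add_div, mul_div_assoc, div_self hwn.ne'] at h6 h7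
  dsimp only
  constructor <;> nlinarith

/-- The solution of the recurrence with all initial values equal to `1`. -/
noncomputable def recSeq (P : ℕ) (c : ℕ → ℕ → ℝ) (n : ℕ) : ℝ :=
  if n < P then 1 else ∑ j : Fin P, c (n - P) j * recSeq P c (n - 1 - j)
termination_by n
decreasing_by
  have := j.2
  omega

theorem recSeq_of_lt {n : ℕ} (h : n < P) : recSeq P c n = 1 := by
  rw [recSeq, if_pos h]

theorem recSeq_solves : Solves P c (recSeq P c) := by
  intro n
  rw [recSeq, if_neg (by omega),
    ← Fin.sum_univ_eq_sum_range (fun j => c n j * recSeq P c (n + P - 1 - j))]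
  simp

theorem recSeq_le_succ (hP : 0 < P) (hc : ∀ n j, 0 ≤ c n j) (hc0 : ∀ n, 1 ≤ c n 0) (n : ℕ) :
    0 < recSeq P c n ∧ recSeq P c n ≤ recSeq P c (n + 1) := by
  have hpos : ∀ n, 0 < recSeq P c n := by
    intro n
    induction n using Nat.strong_induction_on with
    | _ n ih =>
      by_cases h : n < P
      · rw [recSeq_of_lt h]; exact one_pos
      · have h1 := recSeq_solves.pred_le hP hc hc0 (n := n - P)
          (fun k hk => (ih (n - P + k) (by omega)).le)
        rw [show n - P + P - 1 = n - 1 by omega, show n - P + P = n by omega] at h1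
        exact (ih (n - 1) (by omega)).trans_le h1
  refine ⟨hpos n, ?_⟩
  by_cases h : n + 1 < P
  · rw [recSeq_of_lt h, recSeq_of_lt (by omega)]
  · have h1 := recSeq_solves.pred_le hP hc hc0 (n := n + 1 - P) (fun k _ => (hpos _).le)
    rwa [show n + 1 - P + P - 1 = n by omega, show n + 1 - P + P = n + 1 by omega] at h1

theorem prod_ratio {w : ℕ → ℝ} (hw : ∀ n, 0 < w n) {n k : ℕ} (hk : k ≤ n) :
    ∏ i ∈ Finset.range k, w (n - 1 - i + 1) / w (n - 1 - i) = w n / w (n - k) := by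
  induction k with
  | zero => simp [(hw n).ne']
  | succ k ih =>
    rw [Finset.prod_range_succ, ih (by omega), show n - 1 - k + 1 = n - k by omega,
      show n - 1 - k = n - (k + 1) by omega]
    have := (hw (n - k)).ne'
    have := (hw (n - (k + 1))).ne'
    field_simp

theorem exists_periodic_growth (hP : 0 < P) (hc : ∀ n j, 0 ≤ c n j) (hc0 : ∀ n, 1 ≤ c n 0)
    (hC : ∀ n, ∑ j ∈ Finset.range P, c n j ≤ C) (hper : ∀ n, c (n + P) = c n) :
    ∃ γ : ℕ → ℝ, (∀ n, 1 ≤ γ n) ∧ (∀ n, γ (n + P) = γ n) ∧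
      ∀ n, ∑ j ∈ Finset.range P, c n j / ∏ i ∈ Finset.range (j + 1), γ (n + P - 1 - i) = 1 := by
  have hC1 : 1 ≤ C := (hc0 0).trans
    ((Finset.single_le_sum (fun j _ => hc 0 j) (Finset.mem_range.2 hP)).trans (hC 0))
  have hw : ∀ n, 0 < recSeq P c n := fun n => (recSeq_le_succ hP hc hc0 n).1
  have hmono : Monotone (recSeq P c) :=
    monotone_nat_of_le_succ fun n => (recSeq_le_succ hP hc hc0 n).2
  have hsol : Solves P c (recSeq P c) := recSeq_solves
  have hinit : ∀ n < P, recSeq P c n = 1 := fun n hn => recSeq_of_lt hn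
  generalize recSeq P c = w at hw hmono hsol hinit
  have hstep : ∀ n, w (n + 1) ≤ C * w n := by
    intro n
    by_cases h : n + 1 < P
    · rw [hinit _ h, hinit n (by omega)]; linarith
    · have := hsol.step_le hc hC hw hmono (n + 1 - P)
      rwa [show n + 1 - P + P - 1 = n by omega, show n + 1 - P + P = n + 1 by omega] at this
  have hsol' : Solves P c (fun n => w (n + P)) := by
    intro n
    dsimp only
    rw [hsol (n + P), hper]
    refine Finset.sum_congr rfl fun j hj => ?_
    have := Finset.mem_range.1 hj
    rw [show n + P + P - 1 - j = n + P - 1 - j + P by omega]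
  obtain ⟨A, ρ, m, hρ0, hρ1, hm, hmr, hgeo⟩ :=
    Solves.ratio_geometric hP hc hc0 hC (fun n => hw (n + P)) hw hmono hsol' hsol
  have hA : 0 ≤ A := by simpa using (abs_nonneg _).trans (hgeo 0 0 0 (by simp) (by simp))
  set q : ℕ → ℝ := fun n => w (n + 1) / w n with hq
  have hq1 : ∀ n, 1 ≤ q n := fun n => (one_le_div (hw n)).2 (hmono (Nat.le_succ n))
  have hqC : ∀ n, q n ≤ C := fun n => (div_le_iff₀ (hw n)).2 (hstep n)
  have hcauchy : ∀ n, CauchySeq fun k => q (n + k * P) := by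
    intro n
    refine cauchySeq_of_le_geometric ρ (C * A / m) hρ1 fun k => ?_
    set N := n + k * P with hN
    rw [show n + (k + 1) * P = N + P by rw [hN]; ring, dist_comm, Real.dist_eq]
    have h1 := hgeo k (N + 1) N (by omega) (by omega)
    have h2 := hmr N
    have e : q (N + P) - q N =
        q N * (w (N + 1 + P) / w (N + 1) - w (N + P) / w N) / (w (N + P) / w N) := by
      have := (hw N).ne'
      have := (hw (N + 1)).ne'
      have := (hw (N + P)).ne'
      simp only [hq, show N + P + 1 = N + 1 + P by omega]
      field_simp
    rw [e, abs_div, abs_mul, abs_of_pos (hm.trans_le h2), abs_of_pos (one_pos.trans_le (hq1 N)),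
      show C * A / m * ρ ^ k = C * (A * ρ ^ k) / m by ring]
    exact div_le_div₀ (by positivity)
      (mul_le_mul (hqC N) h1 (abs_nonneg _) (by linarith)) hm h2
  choose γ hγ using fun n => cauchySeq_tendsto_of_complete (hcauchy n)
  have hγ1 : ∀ n, 1 ≤ γ n := fun n => ge_of_tendsto' (hγ n) fun k => hq1 _
  refine ⟨γ, hγ1, fun n => ?_, fun n => ?_⟩
  · refine tendsto_nhds_unique (hγ (n + P)) ?_
    refine ((hγ n).comp (tendsto_add_atTop_nat 1)).congr fun k => ?_
    simp only [Function.comp]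
    congr 1; ring
  · have hlim : Tendsto (fun k => ∑ j ∈ Finset.range P,
        c n j / ∏ i ∈ Finset.range (j + 1), q (n + P - 1 - i + k * P)) atTop
        (𝓝 (∑ j ∈ Finset.range P, c n j / ∏ i ∈ Finset.range (j + 1), γ (n + P - 1 - i))) := by
      refine tendsto_finsetSum _ fun j _ => Tendsto.div tendsto_const_nhds
        (tendsto_finsetProd _ fun i _ => hγ _) ?_
      exact (Finset.prod_pos fun i _ => one_pos.trans_le (hγ1 _)).ne'
    refine tendsto_nhds_unique hlim (tendsto_const_nhds.congr fun k => ?_)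
    have hcn : c (n + k * P) = c n := by
      induction k with
      | zero => simp
      | succ k ih => rw [← ih, ← hper (n + k * P)]; congr 1; ring
    have h1 := hsol (n + k * P)
    have h2 : (1 : ℝ) = w (n + k * P + P) / w (n + k * P + P) := (div_self (hw _).ne').symm
    rw [h2]
    nth_rewrite 1 [h1]
    rw [Finset.sum_div, hcn]
    refine Finset.sum_congr rfl fun j hj => ?_
    have hj' := Finset.mem_range.1 hj
    have h3 := prod_ratio hw (n := n + k * P + P) (k := j + 1) (by omega)
    have h4 : ∏ i ∈ Finset.range (j + 1), q (n + P - 1 - i + k * P) =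
        w (n + k * P + P) / w (n + k * P + P - (j + 1)) := by
      rw [← h3]
      refine Finset.prod_congr rfl fun i hi => ?_
      have := Finset.mem_range.1 hi
      rw [show n + P - 1 - i + k * P = n + k * P + P - 1 - i by omega]
    rw [h4, show n + k * P + P - (j + 1) = n + k * P + P - 1 - j by omega, div_div_eq_mul_div]

theorem periodic_growth_unique (hP : 0 < P) (hc : ∀ n j, 0 ≤ c n j) (hc0 : ∀ n, 1 ≤ c n 0)
    (hC : ∀ n, ∑ j ∈ Finset.range P, c n j ≤ C) {γ γ' : ℕ → ℝ} (h1 : ∀ n, 1 ≤ γ n)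
    (h1' : ∀ n, 1 ≤ γ' n) (hper : ∀ n, γ (n + P) = γ n) (hper' : ∀ n, γ' (n + P) = γ' n)
    (hγ : ∀ n, ∑ j ∈ Finset.range P, c n j / ∏ i ∈ Finset.range (j + 1), γ (n + P - 1 - i) = 1)
    (hγ' : ∀ n, ∑ j ∈ Finset.range P,
      c n j / ∏ i ∈ Finset.range (j + 1), γ' (n + P - 1 - i) = 1) : γ = γ' := by
  have aux : ∀ g : ℕ → ℝ, (∀ n, 1 ≤ g n) → (∀ n, g (n + P) = g n) →
      (∀ n, ∑ j ∈ Finset.range P, c n j / ∏ i ∈ Finset.range (j + 1), g (n + P - 1 - i) = 1) →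
      ∃ w : ℕ → ℝ, (∀ n, 0 < w n) ∧ Monotone w ∧ Solves P c w ∧ (∀ n, w (n + 1) = w n * g n) ∧
        ∃ t, ∀ n, w (n + P) = t * w n := by
    intro g hg hgp hgs
    have hw : ∀ n, 0 < ∏ i ∈ Finset.range n, g i :=
      fun n => Finset.prod_pos fun i _ => one_pos.trans_le (hg i)
    have hsucc : ∀ n, ∏ i ∈ Finset.range (n + 1), g i = (∏ i ∈ Finset.range n, g i) * g n :=
      fun n => Finset.prod_range_succ _ _
    have hp' : ∀ n, ∏ i ∈ Finset.range (n + P), g i =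
        (∏ i ∈ Finset.range P, g i) * ∏ i ∈ Finset.range n, g i := by
      intro n
      rw [add_comm n P, Finset.prod_range_add]
      congr 1
      exact Finset.prod_congr rfl fun i _ => by rw [add_comm, hgp]
    set w : ℕ → ℝ := fun n => ∏ i ∈ Finset.range n, g i with hwd
    refine ⟨w, hw, monotone_nat_of_le_succ fun n => ?_, fun n => ?_, hsucc, _, hp'⟩
    · simp only [hwd]
      rw [hsucc]
      exact le_mul_of_one_le_right (hw n).le (hg n)
    · have hwn := (hw (n + P)).ne'
      have h := congrArg (fun x => w (n + P) * x) (hgs n)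
      simp only [mul_one, Finset.mul_sum] at h
      rw [← h]
      refine Finset.sum_congr rfl fun j hj => ?_
      have hj' := Finset.mem_range.1 hj
      have h3 := prod_ratio (w := w) hw (n := n + P) (k := j + 1) (by omega)
      have h4 : ∏ i ∈ Finset.range (j + 1), g (n + P - 1 - i) =
          w (n + P) / w (n + P - 1 - j) := by
        rw [show n + P - 1 - j = n + P - (j + 1) by omega, ← h3]
        refine Finset.prod_congr rfl fun i _ => ?_
        rw [eq_div_iff (hw _).ne', mul_comm]
        exact (hsucc _).symm
      rw [h4, div_div_eq_mul_div, mul_div_cancel₀ _ hwn]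
  obtain ⟨w, hw, hwm, hws, hwg, t, hwt⟩ := aux γ h1 hper hγ
  obtain ⟨v, hv, -, hvs, hvg, s, hvt⟩ := aux γ' h1' hper' hγ'
  obtain ⟨A, ρ, m, hρ0, hρ1, hm, hmr, hgeo⟩ :=
    Solves.ratio_geometric hP hc hc0 hC hv hw hwm hvs hws
  set r : ℕ → ℝ := fun n => v n / w n with hr
  have hrp : ∀ n, r (n + P) = s / t * r n := fun n => by
    simp only [hr, hwt, hvt]
    rw [mul_div_mul_comm]
  have hcauchy : CauchySeq r := by
    rw [Metric.cauchySeq_iff']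
    intro ε hε
    have hlim : Tendsto (fun k => A * ρ ^ k) atTop (𝓝 0) := by
      simpa using (tendsto_pow_atTop_nhds_zero_of_lt_one hρ0 hρ1).const_mul A
    obtain ⟨k, hk⟩ := (hlim.eventually_lt_const hε).exists
    exact ⟨k * P, fun n hn => (hgeo k n (k * P) hn le_rfl).trans_lt hk⟩
  obtain ⟨L, hL⟩ := cauchySeq_tendsto_of_complete hcauchy
  have hL0 : 0 < L := hm.trans_le (ge_of_tendsto' hL hmr)
  have hst : s / t = 1 := by
    have h2 := tendsto_nhds_unique ((tendsto_add_atTop_iff_nat P).2 hL)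
      ((hL.const_mul (s / t)).congr fun n => (hrp n).symm)
    exact (mul_eq_right₀ hL0.ne').1 h2.symm
  have hconst : ∀ n, r n = L := by
    intro n
    have hk : ∀ k, r (n + k * P) = r n := by
      intro k
      induction k with
      | zero => simp
      | succ k ih => rw [← ih, show n + (k + 1) * P = n + k * P + P by ring, hrp, hst, one_mul]
    have htop : Tendsto (fun k => n + k * P) atTop atTop :=
      tendsto_atTop_mono
        (fun k => (Nat.le_mul_of_pos_right k hP).trans (Nat.le_add_left _ _)) tendsto_id
    exact tendsto_nhds_unique (tendsto_const_nhds.congr fun k => (hk k).symm) (hL.comp htop)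
  funext n
  have h2 : r (n + 1) = r n := by rw [hconst, hconst]
  have hγn := one_pos.trans_le (h1 n)
  have hwn := (hw n).ne'
  have hvn := (hv n).ne'
  simp only [hr, hwg, hvg] at h2
  rw [mul_div_mul_comm, mul_eq_left₀ (div_ne_zero hvn hwn), div_eq_one_iff_eq hγn.ne'] at h2
  exact h2.symm

end Recurrence

section Valuation

variable {B : ℤ → ℝ} {c : ℤ → ℕ → ℕ} {P : ℕ}

/-- The series defining `valS B n x` converges. -/
def ValSummable (B : ℤ → ℝ) (n : ℤ) (x : ℕ → ℕ) : Prop :=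
  Summable fun j : ℕ => (x j : ℝ) / ∏ i ∈ Finset.range (j + 1), B (n - 1 - i)

theorem EvZero.valSummable {x : ℕ → ℕ} (hx : EvZero x) (n : ℤ) : ValSummable B n x := by
  obtain ⟨N, hN⟩ := hx
  refine summable_of_ne_finset_zero (s := Finset.range N) fun j hj => ?_
  rw [hN j (by simpa using hj)]
  simp

theorem valS_eq_sum {x : ℕ → ℕ} (hx : ∀ j ≥ P, x j = 0) (n : ℤ) :
    valS B n x = ∑ j ∈ Finset.range P, (x j : ℝ) / ∏ i ∈ Finset.range (j + 1), B (n - 1 - i) :=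
  tsum_eq_sum fun j hj => by rw [hx j (by simpa using hj)]; simp

theorem valSummable_of_valS_eq_one {x : ℕ → ℕ} {n : ℤ} (h : valS B n x = 1) :
    ValSummable B n x := by
  by_contra hs
  rw [valS, tsum_eq_zero_of_not_summable hs] at h
  exact zero_ne_one h

theorem valS_nonneg (hB : ∀ n, 0 < B n) (n : ℤ) (x : ℕ → ℕ) : 0 ≤ valS B n x :=
  tsum_nonneg fun _ => div_nonneg (Nat.cast_nonneg _) (Finset.prod_pos fun _ _ => hB _).le

theorem valS_split {x : ℕ → ℕ} {n : ℤ} (hx : ValSummable B n x) (k : ℕ) :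
    valS B n x = ∑ j ∈ Finset.range k, (x j : ℝ) / ∏ i ∈ Finset.range (j + 1), B (n - 1 - i) +
      valS B (n - k) (fun m => x (m + k)) / ∏ i ∈ Finset.range k, B (n - 1 - i) := by
  rw [valS, ← hx.sum_add_tsum_nat_add k, valS, ← tsum_div_const]
  congr 2
  funext j
  rw [div_div, show j + k + 1 = k + (j + 1) by omega, Finset.prod_range_add, mul_comm]
  congr 2
  refine Finset.prod_congr rfl fun i _ => ?_
  congr 1
  push_cast
  ring

theorem valS_lt_of_lex (hB : ∀ n, 0 < B n) {n : ℤ} {x y : ℕ → ℕ} (hx : ValSummable B n x)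
    (hy : ValSummable B n y) {k : ℕ} (heq : ∀ i < k, x i = y i) (hlt : x k < y k)
    (htail : valS B (n - (k + 1 : ℕ)) (fun m => x (m + (k + 1))) < 1) :
    valS B n x < valS B n y := by
  have hD : 0 < ∏ i ∈ Finset.range (k + 1), B (n - 1 - i) := Finset.prod_pos fun _ _ => hB _
  rw [valS_split hx (k + 1), valS_split hy (k + 1), Finset.sum_range_succ, Finset.sum_range_succ,
    Finset.sum_congr rfl fun j hj => by rw [heq j (Finset.mem_range.1 hj)]]
  have h1 : (x k : ℝ) + 1 ≤ y k := by exact_mod_cast hlt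
  have h2 := valS_nonneg hB (n - (k + 1 : ℕ)) fun m => y (m + (k + 1))
  rw [add_assoc, add_assoc, ← add_div, ← add_div]
  refine add_lt_add_right (div_lt_div_of_pos_right ?_ hD) _
  linarith

theorem valS_tail_lt_one (hB : ∀ n, 0 < B n) (hz : ∀ n, ∀ j ≥ P, c n j = 0)
    (hlex : ∀ n, ∀ j : ℕ, 1 ≤ j → lexLt (fun m => c n (m + j)) (c (n - j)))
    (hval : ∀ n, valS B n (c n) = 1) (n : ℤ) (j : ℕ) (hj : 1 ≤ j) :
    valS B (n - j) (fun m => c n (m + j)) < 1 := by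
  obtain ⟨d, hd⟩ : ∃ d, P ≤ j + d := ⟨P, by omega⟩
  induction d generalizing j with
  | zero =>
    rw [valS_eq_sum (P := 0) (fun m _ => hz n _ (by omega))]
    simp
  | succ d ih =>
    obtain ⟨k, hk, hkl⟩ := hlex n j hj
    rw [← hval (n - j)]
    refine valS_lt_of_lex hB (EvZero.valSummable ⟨P, fun m hm => hz n _ (by omega)⟩ _)
      (valSummable_of_valS_eq_one (hval _)) hk hkl ?_
    have := ih (k + 1 + j) (by omega) (by omega)
    simp only [add_assoc] at this ⊢
    rwa [show n - j - ((k + 1 : ℕ) : ℤ) = n - ((k + (1 + j) : ℕ) : ℤ) by push_cast; ring]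

theorem isGreedyOne_of_lex (hB : ∀ n, 0 < B n) (hz : ∀ n, ∀ j ≥ P, c n j = 0)
    (hlex : ∀ n, ∀ j : ℕ, 1 ≤ j → lexLt (fun m => c n (m + j)) (c (n - j)))
    (hval : ∀ n, valS B n (c n) = 1) (n : ℤ) : IsGreedyOne B n (c n) := by
  refine ⟨hval n, fun b hb => ?_⟩
  by_cases hne : ∃ j, b j ≠ c n j
  · classical
    have hmin : ∀ i < Nat.find hne, b i = c n i := fun i hi => not_not.1 (Nat.find_min hne hi)
    rcases lt_or_gt_of_ne (Nat.find_spec hne) with h | h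
    · exact Or.inr ⟨_, hmin, h⟩
    · have := valS_lt_of_lex hB (valSummable_of_valS_eq_one (hval n))
        (valSummable_of_valS_eq_one hb) (fun i hi => (hmin i hi).symm) h
        (valS_tail_lt_one hB hz hlex hval n _ (by omega))
      rw [hb, hval] at this
      exact absurd this (lt_irrefl _)
  · exact Or.inl (funext fun j => not_not.1 (not_exists.1 hne j))

theorem one_lt_of_valS_eq_one (hB : ∀ n, 0 < B n) {x : ℕ → ℕ} {n : ℤ} (hx : lexLt tenOmega x)
    (hval : valS B (n + 1) x = 1) : 1 < B n := by
  obtain ⟨k, hk, hkl⟩ := hx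
  have hten : ∀ j ≥ 1, tenOmega j = 0 := fun j hj => if_neg (by omega)
  have h := valS_lt_of_lex hB (EvZero.valSummable ⟨1, hten⟩ _) (valSummable_of_valS_eq_one hval)
    hk hkl (by
      rw [valS_eq_sum (P := 0) fun m _ => hten _ (by omega)]
      simp)
  rw [hval, valS_eq_sum hten] at h
  simpa [tenOmega, inv_lt_one₀ (hB n)] using h

theorem one_le_of_lexLt_tenOmega {x : ℕ → ℕ} (hx : lexLt tenOmega x) : 1 ≤ x 0 := by
  obtain ⟨k, hk, hkl⟩ := hx
  rcases Nat.eq_zero_or_pos k with rfl | h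
  · simp only [tenOmega, if_true] at hkl
    omega
  · exact (hk 0 h).le

theorem Function.Periodic.apply_toNat_emod {α : Type*} {f : ℤ → α} {q : ℕ} (hq : 0 < q)
    (hf : ∀ n, f (n + q) = f n) (n : ℤ) : f ((n % (q : ℤ)).toNat : ℤ) = f n := by
  have hf' : Function.Periodic f (q : ℤ) := hf
  rw [Int.toNat_of_nonneg (Int.emod_nonneg _ (by omega))]
  conv_rhs => rw [← Int.emod_add_mul_ediv n q, mul_comm]
  exact (hf'.int_mul _ _).symm

theorem valS_natCast_add {x : ℕ → ℕ} (hx : ∀ j ≥ P, x j = 0) (n : ℕ) :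
    valS B (n + P) x = ∑ j ∈ Finset.range P,
      (x j : ℝ) / ∏ i ∈ Finset.range (j + 1), B ((n + P - 1 - i : ℕ) : ℤ) := by
  rw [valS_eq_sum hx]
  refine Finset.sum_congr rfl fun j hj => ?_
  have := Finset.mem_range.1 hj
  congr 1
  refine Finset.prod_congr rfl fun i hi => ?_
  have := Finset.mem_range.1 hi
  congr 1
  omega

theorem valS_shift {q : ℤ} (hB : ∀ n, B (n + q) = B n) (n : ℤ) (x : ℕ → ℕ) :
    valS B (n + q) x = valS B n x := by
  unfold valS
  refine tsum_congr fun j => ?_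
  congr 1
  refine Finset.prod_congr rfl fun i _ => ?_
  rw [← hB (n - 1 - i)]
  congr 1
  ring

theorem exists_base {q : ℕ} {C : ℝ} (hP : 0 < P) (hqP : q ∣ P) (hz : ∀ n, ∀ j ≥ P, c n j = 0)
    (hten : ∀ n, lexLt tenOmega (c n)) (hper : ∀ n, c (n + q) = c n)
    (hC : ∀ n, ∑ j ∈ Finset.range P, (c n j : ℝ) ≤ C) :
    ∃ β : ℤ → ℝ, ((∀ n, 1 < β n) ∧ (∀ n, β (n + q) = β n) ∧ ∀ n, valS β n (c n) = 1) ∧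
      ∀ β' : ℤ → ℝ, (∀ n, 1 < β' n) → (∀ n, β' (n + q) = β' n) →
        (∀ n, valS β' n (c n) = 1) → β' = β := by
  have hmul : ∀ {α : Type} {f : ℤ → α}, (∀ n, f (n + q) = f n) → ∀ n, f (n + P) = f n := by
    intro α f hf n
    obtain ⟨k, rfl⟩ := hqP
    have hf' : Function.Periodic f (q : ℤ) := hf
    have := hf'.nat_mul k n
    rw [mul_comm] at this
    exact_mod_cast this
  have hq : 0 < q := Nat.pos_of_dvd_of_pos hqP hP
  have hperP : ∀ n, c (n + P) = c n := hmul hper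
  set d : ℕ → ℕ → ℝ := fun n j => c (n + P) j with hd
  have hd0 : ∀ n j, 0 ≤ d n j := fun _ _ => Nat.cast_nonneg _
  have hd1 : ∀ n, 1 ≤ d n 0 := fun n => by
    exact Nat.one_le_cast.2 (one_le_of_lexLt_tenOmega (hten _))
  have hdC : ∀ n, ∑ j ∈ Finset.range P, d n j ≤ C := fun n => hC _
  have huniq := fun γ γ' => periodic_growth_unique (γ := γ) (γ' := γ') hP hd0 hd1 hdC
  obtain ⟨γ, hγ1, hγP, hγs⟩ := exists_periodic_growth hP hd0 hd1 hdC (fun n => by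
    funext j
    simp only [hd, Nat.cast_add, hperP])
  have hγq : (fun n => γ (n + q)) = γ := by
    refine huniq _ _ (fun n => hγ1 _) hγ1 (fun n => ?_) hγP (fun n => ?_) hγs
    · rw [← hγP (n + q)]
      congr 1
      omega
    · rw [← hγs (n + q)]
      refine Finset.sum_congr rfl fun j hj => ?_
      have := Finset.mem_range.1 hj
      congr 1
      · simp only [hd]
        rw [← hper]
        congr 2
        push_cast
        ring
      · refine Finset.prod_congr rfl fun i hi => ?_
        have := Finset.mem_range.1 hi
        congr 1
        omega
  set β : ℤ → ℝ := fun z => γ (z % (q : ℤ)).toNat with hβ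
  have hβγ : ∀ n : ℕ, β n = γ n := by
    intro n
    have hp : Function.Periodic γ q := fun n => congrFun hγq n
    simp only [hβ]
    rw [← Int.natCast_mod, Int.toNat_natCast, hp.map_mod_nat]
  have hβq : ∀ n, β (n + q) = β n := fun n => by simp [hβ]
  have hβ0 : ∀ n, 0 < β n := fun n => one_pos.trans_le (hγ1 _)
  have hval : ∀ n, valS β n (c n) = 1 := by
    intro n
    have h := Function.Periodic.apply_toNat_emod (f := fun n => valS β n (c n)) hP
      (fun n => by rw [valS_shift (hmul hβq), hperP]) n
    rw [← h]
    generalize (n % (P : ℤ)).toNat = k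
    rw [← valS_shift (hmul hβq), ← hperP, valS_natCast_add (hz _)]
    simp only [hβγ]
    exact hγs k
  refine ⟨β, ⟨fun n => one_lt_of_valS_eq_one hβ0 (hten _) (hval (n + 1)), hβq, hval⟩,
    fun β' h1 h2 h3 => ?_⟩
  have h := huniq (fun n => β' n) γ (fun n => (h1 n).le) hγ1 (fun n => by
    exact_mod_cast hmul h2 n) hγP (fun n => by
    rw [← valS_natCast_add (hz _)]
    exact h3 _) hγs
  funext n
  rw [← Function.Periodic.apply_toNat_emod hq h2, ← Function.Periodic.apply_toNat_emod hq hβq,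
    hβγ]
  exact congrFun h _

end Valuation

theorem stmt17 (p : ℕ) (hp : 1 ≤ p)
    (a : ℕ → ℕ → ℕ)  -- `a i j` is the digit `a_{i,j+1}`
    (hz : ∀ i < p, EvZero (a i))
    (hlex10 : ∀ i < p, lexLt tenOmega (a i))
    (hcond : ∀ i < p, ∀ j : ℕ, 1 ≤ j →
      lexLt (fun m => a i (m + j)) (a ((((i : ℤ) - j) % (p : ℤ)).toNat))) :
    ∃ β : ℤ → ℝ,
      ((∀ n, 1 < β n) ∧ (∀ n, β (n + p) = β n) ∧
        (∀ i < p, IsGreedyOne β i (a i))) ∧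
      (∀ β' : ℤ → ℝ,
        ((∀ n, 1 < β' n) ∧ (∀ n, β' (n + p) = β' n) ∧
          (∀ i < p, IsGreedyOne β' i (a i))) → β' = β) := by
  have hp0 : (p : ℤ) ≠ 0 := by omega
  have hmod : ∀ n : ℤ, (n % (p : ℤ)).toNat < p := fun n => by
    have := Int.emod_nonneg n hp0
    have := Int.emod_lt_of_pos n (show (0 : ℤ) < p by omega)
    omega
  have hcast : ∀ n : ℤ, (((n % (p : ℤ)).toNat : ℕ) : ℤ) = n % (p : ℤ) := fun n =>
    Int.toNat_of_nonneg (Int.emod_nonneg n hp0)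
  obtain ⟨N, hN1, hN⟩ : ∃ N, 1 ≤ N ∧ ∀ i < p, ∀ j ≥ N, a i j = 0 := by
    choose! M hM using hz
    refine ⟨(Finset.range p).sup M + 1, by omega, fun i hi j hj => hM i hi j ?_⟩
    have := Finset.le_sup (f := M) (Finset.mem_range.2 hi)
    omega
  set c : ℤ → ℕ → ℕ := fun n => a (n % (p : ℤ)).toNat with hc
  have hca : ∀ i < p, c i = a i := fun i hi => by
    simp only [hc]
    rw [← Int.natCast_mod, Int.toNat_natCast, Nat.mod_eq_of_lt hi]
  have hzero : ∀ n, ∀ j ≥ p * N, c n j = 0 := fun n j hj =>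
    hN _ (hmod n) j ((Nat.le_mul_of_pos_left N hp).trans hj)
  have hlex : ∀ n, ∀ j : ℕ, 1 ≤ j → lexLt (fun m => c n (m + j)) (c (n - j)) := by
    intro n j hj
    have h := hcond _ (hmod n) j hj
    rwa [hcast, Int.emod_sub_emod] at h
  have hcp : ∀ n, c (n + p) = c n := fun n => by simp [hc]
  obtain ⟨β, ⟨h1, h2, h3⟩, huniq⟩ := exists_base (q := p)
    (C := ∑ i ∈ Finset.range p, ∑ j ∈ Finset.range (p * N), (a i j : ℝ))
    (Nat.mul_pos hp hN1) (Nat.dvd_mul_right p N) hzero (fun n => hlex10 _ (hmod n)) hcp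
    (fun n => Finset.single_le_sum (f := fun i => ∑ j ∈ Finset.range (p * N), (a i j : ℝ))
      (fun i _ => Finset.sum_nonneg fun _ _ => Nat.cast_nonneg _) (Finset.mem_range.2 (hmod n)))
  refine ⟨β, ⟨h1, h2, fun i hi => ?_⟩, fun β' ⟨h1', h2', h3'⟩ => huniq β' h1' h2' fun n => ?_⟩
  · rw [← hca i hi]
    exact isGreedyOne_of_lex (fun n => one_pos.trans (h1 n)) hzero hlex h3 i
  · have h := Function.Periodic.apply_toNat_emod (f := fun n => valS β' n (c n)) hp
      (fun n => by rw [valS_shift h2', hcp]) n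
    rw [← h]
    rw [hca _ (hmod n)]
    exact (h3' _ (hmod n)).1
end

section
/- Let p ≥ 1 and for each i ∈ {0,…,p−1} let 𝐚_i = a_{i,1}a_{i,2}⋯ be a sequence of nonnegative integers with a_{i,1} ≥ 1, not eventually zero, and satisfying a_{i,j+1}a_{i,j+2}⋯ ≤_lex 𝐚_{(i−j) mod p} for all j ≥ 1. Then there exists an alternate base B = (β_{p−1},…,β_0) of length p such that for every i ∈ {0,…,p−1}, 𝐚_i is the quasi-greedy S^i(B)-expansion of 1. Moreover, B is the unique alternate base of length p with this property if either 𝐚_0,…,𝐚_{p−1} are all ultimately periodic, or a_{i,1} ≥ 2 for all i ∈ {0,…,p−1}. -/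
/-- Ultimately periodic sequence. -/
def UltPer (x : ℕ → ℕ) : Prop := ∃ m q : ℕ, 1 ≤ q ∧ ∀ j : ℕ, m ≤ j → x (j + q) = x j

open Finset Filter Topology

/-- The linear operator whose positive fixed points `w` correspond to the alternate bases
`n ↦ w (n + 1) / w n` in which every `A n` is an expansion of `1`. -/
noncomputable def digitSum (A : ℤ → ℕ → ℕ) (w : ℤ → ℝ) (n : ℤ) : ℝ :=
  ∑' j : ℕ, (A n j : ℝ) * w (n - 1 - j)

/-- Positive weights, multiplied by `δ` along each period, that dominate their digit sums. -/
structure IsSupersolution (A : ℤ → ℕ → ℕ) (p : ℕ) (δ : ℝ) (w : ℤ → ℝ) : Prop where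
  pos : ∀ n, 0 < w n
  shift : ∀ n, w (n + p) = δ * w n
  sum_le : ∀ n N, ∑ j ∈ range N, (A n j : ℝ) * w (n - 1 - j) ≤ w n

namespace IsSupersolution

variable {A : ℤ → ℕ → ℕ} {p : ℕ} {δ : ℝ} {w : ℤ → ℝ}

theorem term_nonneg (h : IsSupersolution A p δ w) (n : ℤ) (j : ℕ) :
    0 ≤ (A n j : ℝ) * w (n - 1 - j) :=
  mul_nonneg (Nat.cast_nonneg _) (h.pos _).le

theorem summable (h : IsSupersolution A p δ w) (n : ℤ) :
    Summable fun j : ℕ => (A n j : ℝ) * w (n - 1 - j) :=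
  summable_of_sum_range_le (h.term_nonneg n) (h.sum_le n)

theorem digitSum_le (h : IsSupersolution A p δ w) (n : ℤ) : digitSum A w n ≤ w n :=
  Real.tsum_le_of_sum_range_le (h.term_nonneg n) (h.sum_le n)

theorem digitSum_nonneg (h : IsSupersolution A p δ w) (n : ℤ) : 0 ≤ digitSum A w n :=
  tsum_nonneg (h.term_nonneg n)

theorem of_digitSum_le (hpos : ∀ n, 0 < w n) (hshift : ∀ n, w (n + p) = δ * w n)
    (hs : ∀ n, Summable fun j : ℕ => (A n j : ℝ) * w (n - 1 - j))
    (hle : ∀ n, digitSum A w n ≤ w n) : IsSupersolution A p δ w :=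
  ⟨hpos, hshift, fun n _ => ((hs n).sum_le_tsum _ fun _ _ =>
    mul_nonneg (Nat.cast_nonneg _) (hpos _).le).trans (hle n)⟩

theorem shift_sub (h : IsSupersolution A p δ w) (n : ℤ) (j : ℕ) :
    w (n + p - 1 - j) = δ * w (n - 1 - j) := by
  rw [← h.shift]; congr 1; ring

theorem digitSum_shift (h : IsSupersolution A p δ w) (hA : ∀ n, A (n + p) = A n) (n : ℤ) :
    digitSum A w (n + p) = δ * digitSum A w n := by
  unfold digitSum
  rw [← tsum_mul_left]
  refine tsum_congr fun j => ?_
  rw [hA, h.shift_sub]; ring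

theorem le_succ (h : IsSupersolution A p δ w) (h0 : ∀ n, 1 ≤ A n 0) (n : ℤ) :
    w n ≤ w (n + 1) := by
  have h1 := h.sum_le (n + 1) 1
  have h2 : (1 : ℝ) ≤ A (n + 1) 0 := by exact_mod_cast h0 _
  simp only [sum_range_one, Nat.cast_zero, sub_zero, add_sub_cancel_right] at h1
  nlinarith [h.pos n]

theorem mono (h : IsSupersolution A p δ w) (h0 : ∀ n, 1 ≤ A n 0) : Monotone w :=
  monotone_int_of_le_succ (h.le_succ h0)

theorem lt_succ (h : IsSupersolution A p δ w) (h0 : ∀ n, 1 ≤ A n 0)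
    (hnz : ∀ n, ¬ EvZero (A n)) (n : ℤ) : w n < w (n + 1) := by
  obtain ⟨k, hk, hk0⟩ : ∃ k, 1 ≤ k ∧ A (n + 1) k ≠ 0 := by
    by_contra! hc
    exact hnz (n + 1) ⟨1, hc⟩
  have h1 := h.sum_le (n + 1) (k + 1)
  have h2 : (1 : ℝ) ≤ A (n + 1) 0 := by exact_mod_cast h0 _
  have h3 : ∑ j ∈ ({0, k} : Finset ℕ), (A (n + 1) j : ℝ) * w (n + 1 - 1 - j) ≤
      ∑ j ∈ range (k + 1), (A (n + 1) j : ℝ) * w (n + 1 - 1 - j) := by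
    refine sum_le_sum_of_subset_of_nonneg ?_ fun j _ _ => h.term_nonneg _ _
    intro j hj
    simp only [mem_insert, mem_singleton] at hj
    simp only [mem_range]; omega
  rw [sum_pair (by omega)] at h3
  have h4 : 0 < (A (n + 1) k : ℝ) * w (n + 1 - 1 - k) :=
    mul_pos (by exact_mod_cast Nat.pos_of_ne_zero hk0) (h.pos _)
  simp only [Nat.cast_zero, sub_zero, add_sub_cancel_right] at h3 h4 h1
  nlinarith [h.pos n]

theorem div_const (h : IsSupersolution A p δ w) {c : ℝ} (hc : 0 < c) :
    IsSupersolution A p δ fun n => w n / c where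
  pos n := div_pos (h.pos n) hc
  shift n := by rw [h.shift]; ring
  sum_le n N := by
    simp_rw [← mul_div_assoc]
    rw [← sum_div]
    exact div_le_div_of_nonneg_right (h.sum_le n N) hc.le

/-- Adding the digit sums preserves strict inequalities and passes them on to the next index. -/
theorem add_digitSum (h : IsSupersolution A p δ w) (hA : ∀ n, A (n + p) = A n)
    (h0 : ∀ n, 1 ≤ A n 0) :
    ∃ v, IsSupersolution A p δ v ∧ ∀ n, digitSum A w n < w n →
      digitSum A v n < v n ∧ digitSum A v (n + 1) < v (n + 1) := by
  have hs : ∀ n, Summable fun j : ℕ => (A n j : ℝ) * digitSum A w (n - 1 - j) := fun n =>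
    Summable.of_nonneg_of_le
      (fun j => mul_nonneg (Nat.cast_nonneg _) (h.digitSum_nonneg _))
      (fun j => mul_le_mul_of_nonneg_left (h.digitSum_le _) (Nat.cast_nonneg _)) (h.summable n)
  have hle : ∀ n, digitSum A (digitSum A w) n ≤ digitSum A w n := fun n =>
    (hs n).tsum_le_tsum
      (fun j => mul_le_mul_of_nonneg_left (h.digitSum_le _) (Nat.cast_nonneg _)) (h.summable n)
  have hadd : ∀ n, digitSum A (fun m => w m + digitSum A w m) n =
      digitSum A w n + digitSum A (digitSum A w) n := fun n => by
    have := (h.summable n).tsum_add (hs n)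
    simp_rw [← mul_add] at this
    exact this
  refine ⟨fun m => w m + digitSum A w m, of_digitSum_le ?_ ?_ ?_ ?_, ?_⟩
  · exact fun n => add_pos_of_pos_of_nonneg (h.pos n) (h.digitSum_nonneg n)
  · intro n
    rw [h.shift, h.digitSum_shift hA]; ring
  · intro n
    simp_rw [mul_add]
    exact (h.summable n).add (hs n)
  · intro n
    rw [hadd]
    linarith [hle n, h.digitSum_le n]
  · intro n hn
    refine ⟨by rw [hadd]; linarith [hle n], ?_⟩
    have : digitSum A (digitSum A w) (n + 1) < digitSum A w (n + 1) := by
      refine (hs _).tsum_lt_tsum (i := 0)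
        (fun j => mul_le_mul_of_nonneg_left (h.digitSum_le _) (Nat.cast_nonneg _)) ?_ (h.summable _)
      have h2 : (0 : ℝ) < A (n + 1) 0 := by exact_mod_cast h0 _
      simpa using mul_lt_mul_of_pos_left hn h2
    rw [hadd]
    linarith [h.digitSum_le (n + 1)]

theorem exists_strict_upto (h : IsSupersolution A p δ w) (hA : ∀ n, A (n + p) = A n)
    (h0 : ∀ n, 1 ≤ A n 0) {m : ℤ} (hm : digitSum A w m < w m) (k : ℕ) :
    ∃ v, IsSupersolution A p δ v ∧ ∀ l : ℕ, l ≤ k → digitSum A v (m + l) < v (m + l) := by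
  induction k with
  | zero =>
    refine ⟨w, h, fun l hl => ?_⟩
    obtain rfl : l = 0 := by omega
    simpa using hm
  | succ k ih =>
    obtain ⟨v, hv, hvs⟩ := ih
    obtain ⟨u, hu, hus⟩ := hv.add_digitSum hA h0
    refine ⟨u, hu, fun l hl => ?_⟩
    rcases hl.lt_or_eq with hl | rfl
    · exact (hus _ (hvs l (by omega))).1
    · have := (hus _ (hvs k le_rfl)).2
      push_cast
      rwa [← add_assoc]

end IsSupersolution

/-- A property of an integer that is invariant under translation by `p` holds everywhere as soon as
it holds on one period. -/
theorem forall_int_of_period {p : ℕ} (hp : 1 ≤ p) {P : ℤ → Prop} (hP : ∀ n, P (n + p) ↔ P n)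
    (m : ℤ) (hm : ∀ l : ℕ, l < p → P (m + l)) (n : ℤ) : P n := by
  have hper : Function.Periodic P (p : ℤ) := fun k => propext (hP k)
  have hp' : (0 : ℤ) < p := by exact_mod_cast hp
  have h1 := hm ((n - m) % p).toNat (by have := Int.emod_lt_of_pos (n - m) hp'; omega)
  rw [Int.toNat_of_nonneg (Int.emod_nonneg _ hp'.ne')] at h1
  have h2 := hper.int_mul ((n - m) / p) (m + (n - m) % p)
  have h3 : m + (n - m) % p + (n - m) / p * p = n := by
    have := Int.emod_add_mul_ediv (n - m) p
    linarith
  rw [Int.cast_id, h3] at h2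
  exact h2 ▸ h1

namespace IsSupersolution

variable {A : ℤ → ℕ → ℕ} {p : ℕ} {δ : ℝ} {w : ℤ → ℝ}

theorem delta_pos (h : IsSupersolution A p δ w) : 0 < δ := by
  have h1 := h.shift 0
  have h2 := h.pos (0 + p)
  rw [h1] at h2
  exact pos_of_mul_pos_left h2 (h.pos 0).le

theorem exists_growth (h : IsSupersolution A p δ w) (hp : 1 ≤ p) (h0 : ∀ n, 1 ≤ A n 0)
    (hnz : ∀ n, ¬ EvZero (A n)) : ∃ c : ℝ, 1 < c ∧ ∀ n, c * w n ≤ w (n + 1) := by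
  have hev : ∀ᶠ c : ℝ in 𝓝 1, ∀ l ∈ range p, c * w (0 + l) < w (0 + l + 1) := by
    rw [Filter.eventually_all_finset]
    intro l _
    have : Tendsto (fun c : ℝ => c * w (0 + l)) (𝓝 1) (𝓝 (1 * w (0 + l))) :=
      tendsto_id.mul_const _
    exact this.eventually_lt_const (by rw [one_mul]; exact h.lt_succ h0 hnz _)
  obtain ⟨c, hc, hc1⟩ := ((hev.filter_mono (nhdsWithin_le_nhds (s := Set.Ioi 1))).and
    self_mem_nhdsWithin).exists
  refine ⟨c, hc1, forall_int_of_period hp (fun n => ?_) 0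
    fun l hl => (hc l (mem_range.2 hl)).le⟩
  rw [add_right_comm, h.shift, h.shift, mul_left_comm]
  exact mul_le_mul_iff_right₀ h.delta_pos

theorem le_div_pow {c : ℝ} (hc : 1 < c)
    (hw : ∀ n, c * w n ≤ w (n + 1)) (n : ℤ) (j : ℕ) : w (n - j) ≤ w n / c ^ j := by
  have hc0 : 0 < c := by linarith
  induction j with
  | zero => simp
  | succ j ih =>
    rw [pow_succ, ← div_div, le_div_iff₀ hc0, mul_comm]
    refine (hw _).trans (le_trans (le_of_eq ?_) ih)
    congr 1; push_cast; ring

/-- If all inequalities are strict then the period factor can be decreased. -/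
theorem exists_lt_of_strict (h : IsSupersolution A p δ w) (hp : 1 ≤ p)
    (hA : ∀ n, A (n + p) = A n) (h0 : ∀ n, 1 ≤ A n 0) (hnz : ∀ n, ¬ EvZero (A n))
    {D : ℕ} (hD : ∀ n j, A n j ≤ D) (m : ℤ)
    (hst : ∀ l : ℕ, l < p → digitSum A w (m + l) < w (m + l)) :
    ∃ δ' v, IsSupersolution A p δ' v ∧ δ' < δ := by
  obtain ⟨c, hc1, hc⟩ := h.exists_growth hp h0 hnz
  obtain ⟨b, hb1, hbc⟩ := exists_between hc1
  have hb0 : 0 < b := by linarith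
  have hc0 : 0 < c := by linarith
  have hbound : ∀ n : ℤ, ∀ r : ℝ, 0 < r → r < b → ∀ j : ℕ,
      ‖(A n j : ℝ) * w (n - 1 - j) * r ^ (j + 1)‖ ≤ D * w (n - 1) * b * (b / c) ^ j := by
    intro n r hr hrb j
    have e1 := le_div_pow hc1 hc (n - 1) j
    have e2 : (A n j : ℝ) ≤ D := by exact_mod_cast hD n j
    have e3 : r ^ (j + 1) ≤ b ^ (j + 1) := pow_le_pow_left₀ hr.le hrb.le _
    have e4 := h.pos (n - 1 - j)
    have e5 := h.pos (n - 1)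
    rw [Real.norm_of_nonneg (mul_nonneg (h.term_nonneg n j) (by positivity))]
    calc (A n j : ℝ) * w (n - 1 - j) * r ^ (j + 1)
        ≤ D * (w (n - 1) / c ^ j) * b ^ (j + 1) := by gcongr
      _ = D * w (n - 1) * b * (b / c) ^ j := by rw [div_pow, pow_succ]; ring
  have hgeo : ∀ n : ℤ, Summable fun j : ℕ => D * w (n - 1) * b * (b / c) ^ j := fun n =>
    (summable_geometric_of_lt_one (by positivity) ((div_lt_one hc0).2 hbc)).mul_left _
  have hnear : ∀ᶠ r : ℝ in 𝓝 1, 0 < r ∧ r < b :=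
    (eventually_gt_nhds one_pos).and (eventually_lt_nhds hb1)
  have hev : ∀ᶠ r : ℝ in 𝓝 1, ∀ l ∈ range p,
      ∑' j : ℕ, (A (m + l) j : ℝ) * w (m + l - 1 - j) * r ^ (j + 1) < w (m + l) := by
    rw [Filter.eventually_all_finset]
    intro l hl
    have ht : Tendsto (fun r : ℝ => ∑' j : ℕ, (A (m + l) j : ℝ) * w (m + l - 1 - j) * r ^ (j + 1))
        (𝓝 1) (𝓝 (∑' j : ℕ, (A (m + l) j : ℝ) * w (m + l - 1 - j) * 1 ^ (j + 1))) := by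
      refine tendsto_tsum_of_dominated_convergence (hgeo (m + l)) (fun j => ?_) ?_
      · exact (tendsto_id.pow _).const_mul _
      · filter_upwards [hnear] with r hr
        exact hbound _ r hr.1 hr.2
    refine ht.eventually_lt_const ?_
    simp only [one_pow, mul_one]
    exact hst l (mem_range.1 hl)
  obtain ⟨r, ⟨hr, hr0, hrb⟩, hr1⟩ :=
    (((hev.and hnear).filter_mono (nhdsWithin_le_nhds (s := Set.Ioi 1))).and
      self_mem_nhdsWithin).exists
  have hr1 : 1 < r := hr1
  have hall : ∀ n : ℤ, ∑' j : ℕ, (A n j : ℝ) * w (n - 1 - j) * r ^ (j + 1) ≤ w n := by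
    refine forall_int_of_period hp (fun n => ?_) m fun l hl => (hr l (mem_range.2 hl)).le
    have : ∑' j : ℕ, (A (n + p) j : ℝ) * w (n + p - 1 - j) * r ^ (j + 1) =
        δ * ∑' j : ℕ, (A n j : ℝ) * w (n - 1 - j) * r ^ (j + 1) := by
      rw [← tsum_mul_left]
      refine tsum_congr fun j => ?_
      rw [hA, h.shift_sub]; ring
    rw [this, h.shift]
    exact mul_le_mul_iff_right₀ h.delta_pos
  have hterm : ∀ (n : ℤ) (j : ℕ), (A n j : ℝ) * (w (n - 1 - j) * r ^ (-(n - 1 - j))) =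
      (A n j : ℝ) * w (n - 1 - j) * r ^ (j + 1) * r ^ (-n) := by
    intro n j
    have : r ^ (-(n - 1 - j)) = r ^ (j + 1) * r ^ (-n) := by
      rw [← zpow_natCast, ← zpow_add₀ hr0.ne']; congr 1; push_cast; ring
    rw [this]; ring
  refine ⟨δ * r ^ (-(p : ℤ)), fun n => w n * r ^ (-n), of_digitSum_le ?_ ?_ ?_ ?_, ?_⟩
  · exact fun n => mul_pos (h.pos n) (zpow_pos hr0 _)
  · intro n
    rw [h.shift, neg_add, zpow_add₀ hr0.ne']; ring
  · intro n
    simp_rw [hterm]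
    exact (Summable.of_norm_bounded (hgeo n) (hbound n r hr0 hrb)).mul_right _
  · intro n
    unfold digitSum
    simp_rw [hterm]
    rw [tsum_mul_right]
    exact mul_le_mul_of_nonneg_right (hall n) (zpow_pos hr0 _).le
  · refine mul_lt_of_lt_one_right h.delta_pos ?_
    rw [zpow_neg, zpow_natCast]
    exact inv_lt_one_of_one_lt₀ (one_lt_pow₀ hr1 (by omega))

theorem pow_shift (h : IsSupersolution A p δ w) (n : ℤ) (k : ℕ) :
    w (n + k * p) = δ ^ k * w n := by
  induction k with
  | zero => simp
  | succ k ih =>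
    have : n + ((k + 1 : ℕ) : ℤ) * p = n + k * p + p := by push_cast; ring
    rw [this, h.shift, ih, pow_succ]; ring

/-- Supersolutions with the least possible period factor exist, by compactness. -/
theorem exists_least (h : IsSupersolution A p δ w) (hp : 1 ≤ p) (h0 : ∀ n, 1 ≤ A n 0) :
    ∃ δ₁ v, IsSupersolution A p δ₁ v ∧ ∀ δ₂ u, IsSupersolution A p δ₂ u → δ₁ ≤ δ₂ := by
  set K : Set (ℤ → ℝ) := (Set.univ.pi fun n : ℤ => Set.Icc (0 : ℝ) (δ ^ n.toNat)) ∩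
    {u | u 0 = 1 ∧ (∀ n, u (n + p) = u p * u n) ∧
      (∀ n N, ∑ j ∈ range N, (A n j : ℝ) * u (n - 1 - j) ≤ u n)} with hK
  have hp' : (1 : ℤ) ≤ p := by exact_mod_cast hp
  have hmem : ∀ δ₂ u, IsSupersolution A p δ₂ u → δ₂ ≤ δ →
      (fun n => u n / u 0) ∈ K ∧ u p / u 0 = δ₂ := by
    intro δ₂ u hu hle
    have hv := hu.div_const (hu.pos 0)
    have hup : u p = δ₂ * u 0 := by simpa using hu.shift 0
    have hup' : u p / u 0 = δ₂ := by rw [hup, mul_div_cancel_right₀ _ (hu.pos 0).ne']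
    refine ⟨⟨fun n _ => ⟨(hv.pos n).le, ?_⟩, div_self (hu.pos 0).ne', fun n => ?_, hv.sum_le⟩, hup'⟩
    · have h1 : n ≤ 0 + n.toNat * p := by nlinarith [Int.self_le_toNat n, Int.natCast_nonneg n.toNat]
      refine (hv.mono h0 h1).trans ?_
      rw [hv.pow_shift, div_self (hu.pos 0).ne', mul_one]
      exact pow_le_pow_left₀ hu.delta_pos.le hle _
    · change _ = u p / u 0 * _
      rw [hup']
      exact hv.shift n
  have hKc : IsCompact K := by
    refine (isCompact_univ_pi fun n => isCompact_Icc).inter_right ?_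
    simp only [Set.ofPred_and, Set.ofPred_forall]
    refine (isClosed_eq (by fun_prop) (by fun_prop)).inter (IsClosed.inter ?_ ?_)
    · exact isClosed_iInter fun n => isClosed_eq (by fun_prop) (by fun_prop)
    · exact isClosed_iInter fun n => isClosed_iInter fun N => isClosed_le (by fun_prop) (by fun_prop)
  obtain ⟨v, hvK, hvmin⟩ := hKc.exists_isMinOn ⟨_, (hmem δ w h le_rfl).1⟩
    (f := fun u : ℤ → ℝ => u p) (by fun_prop)
  obtain ⟨hbox, hv0, hvs, hvsum⟩ := hvK
  have hnn : ∀ n, 0 ≤ v n := fun n => (hbox n (Set.mem_univ n)).1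
  have hmono : Monotone v := by
    refine monotone_int_of_le_succ fun n => ?_
    have h1 := hvsum (n + 1) 1
    have h2 : (1 : ℝ) ≤ A (n + 1) 0 := by exact_mod_cast h0 _
    simp only [sum_range_one, Nat.cast_zero, sub_zero, add_sub_cancel_right] at h1
    nlinarith [hnn n]
  have hpos : ∀ n, 0 < v n := by
    intro n
    refine (hnn n).lt_of_ne' fun hn => ?_
    have hk : ∀ k : ℕ, v (n + k * p) = 0 := by
      intro k
      induction k with
      | zero => simpa using hn
      | succ k ih =>
        have : n + ((k + 1 : ℕ) : ℤ) * p = n + k * p + p := by push_cast; ring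
        rw [this, hvs, ih, mul_zero]
    have h1 := hk (-n).toNat
    have h2 : 0 ≤ n + (-n).toNat * p := by
      nlinarith [Int.self_le_toNat (-n), Int.natCast_nonneg (-n).toNat]
    have := hmono h2
    rw [hv0, h1] at this
    linarith
  have hv : IsSupersolution A p (v p) v := ⟨hpos, hvs, hvsum⟩
  refine ⟨v p, v, hv, fun δ₂ u hu => ?_⟩
  have key : ∀ δ₂ u, IsSupersolution A p δ₂ u → δ₂ ≤ δ → v p ≤ δ₂ := fun δ₂ u hu hle => by
    obtain ⟨h1, h2⟩ := hmem δ₂ u hu hle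
    rw [← h2]
    exact hvmin h1
  rcases le_total δ₂ δ with hle | hle
  · exact key δ₂ u hu hle
  · exact (key δ w h le_rfl).trans hle

end IsSupersolution

theorem isSupersolution_zpow {A : ℤ → ℕ → ℕ} (p : ℕ) {D : ℕ} (hD : ∀ n j, A n j ≤ D) :
    IsSupersolution A p ((D + 1 : ℝ) ^ p) fun n => (D + 1 : ℝ) ^ n := by
  have hD0 : (0 : ℝ) < D + 1 := by positivity
  refine ⟨fun n => zpow_pos hD0 n, fun n => ?_, fun n N => ?_⟩
  · rw [zpow_add₀ hD0.ne', zpow_natCast, mul_comm]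
  · suffices h : ∑ j ∈ range N, (A n j : ℝ) * (D + 1 : ℝ) ^ (n - 1 - j) ≤
        (D + 1 : ℝ) ^ n - (D + 1 : ℝ) ^ (n - N) by
      linarith [zpow_pos hD0 (n - N)]
    induction N with
    | zero => simp
    | succ N ih =>
      rw [sum_range_succ]
      have e1 : (D + 1 : ℝ) ^ (n - N) = (D + 1) * (D + 1 : ℝ) ^ (n - 1 - N) := by
        rw [← zpow_one_add₀ hD0.ne']; congr 1; ring
      have e2 : n - ((N + 1 : ℕ) : ℤ) = n - 1 - N := by push_cast; ring
      have e3 : (A n N : ℝ) ≤ D := by exact_mod_cast hD n N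
      rw [e2]
      nlinarith [zpow_pos hD0 (n - 1 - N)]

/-- Existence of a positive eigenvector for periodic digits. -/
theorem exists_digitSum_eq {A : ℤ → ℕ → ℕ} {p D : ℕ} (hp : 1 ≤ p)
    (hA : ∀ n, A (n + p) = A n) (h0 : ∀ n, 1 ≤ A n 0) (hnz : ∀ n, ¬ EvZero (A n))
    (hD : ∀ n j, A n j ≤ D) :
    ∃ δ w, IsSupersolution A p δ w ∧ ∀ n, digitSum A w n = w n := by
  obtain ⟨δ, w, h, hmin⟩ := (isSupersolution_zpow p hD).exists_least hp h0
  refine ⟨δ, w, h, fun n => (h.digitSum_le n).antisymm ?_⟩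
  by_contra! hlt
  obtain ⟨v, hv, hvs⟩ := h.exists_strict_upto hA h0 hlt p
  obtain ⟨δ', u, hu, hδ⟩ := hv.exists_lt_of_strict hp hA h0 hnz hD n fun l hl => hvs l hl.le
  exact (hmin δ' u hu).not_gt hδ

theorem lexLe.head_le {x y : ℕ → ℕ} (h : lexLe x y) : x 0 ≤ y 0 := by
  rcases h with rfl | ⟨j, hj, hlt⟩
  · exact le_rfl
  · rcases Nat.eq_zero_or_pos j with rfl | hj0
    · exact hlt.le
    · exact (hj 0 hj0).le

theorem lexLt_of_not_lexLe {x y : ℕ → ℕ} (h : ¬ lexLe x y) : lexLt y x := by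
  have hne : ∃ j, x j ≠ y j := by
    by_contra! hc
    exact h (Or.inl (funext hc))
  classical
  refine ⟨Nat.find hne, fun i hi => (not_not.1 (Nat.find_min hne hi)).symm, ?_⟩
  refine (Nat.find_spec hne).lt_or_gt.resolve_left fun hlt => h (Or.inr ?_)
  exact ⟨Nat.find hne, fun i hi => not_not.1 (Nat.find_min hne hi), hlt⟩

namespace IsSupersolution

variable {A : ℤ → ℕ → ℕ} {p : ℕ} {δ : ℝ} {w : ℤ → ℝ}

/-- Parry's argument: a sequence all of whose shifts are lexicographically dominated by the
corresponding `A n` has value at most `1`. -/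
theorem sum_le_of_lexLe (h : IsSupersolution A p δ w) (N : ℕ) (m : ℤ) (x : ℕ → ℕ)
    (hx : ∀ k : ℕ, lexLe (fun i => x (i + k)) (A (m - k))) :
    ∑ k ∈ range N, (x k : ℝ) * w (m - 1 - k) ≤ w m := by
  induction N using Nat.strong_induction_on generalizing m x with
  | _ N ih =>
    have hx0 : lexLe x (A m) := by simpa using hx 0
    rcases hx0 with rfl | ⟨j, hj, hlt⟩
    · exact h.sum_le m N
    · rcases le_or_gt N j with hN | hN
      · refine le_trans (le_of_eq (sum_congr rfl fun k hk => ?_)) (h.sum_le m N)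
        rw [hj k ((mem_range.1 hk).trans_le hN)]
      · obtain ⟨M, rfl⟩ : ∃ M, N = j + 1 + M := ⟨N - (j + 1), by omega⟩
        have htail := ih M (by omega) (m - 1 - j) (fun i => x (i + (j + 1))) fun k => by
          convert hx (k + (j + 1)) using 2
          · simp only [add_assoc]
          · push_cast; ring
        have e : ∀ k : ℕ, m - 1 - ((j + 1 + k : ℕ) : ℤ) = m - 1 - j - 1 - k := fun k => by
          push_cast; ring
        rw [sum_range_add]
        simp_rw [e]
        simp_rw [add_comm _ (j + 1)] at htail
        have hpre := h.sum_le m (j + 1)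
        rw [sum_range_succ] at hpre ⊢
        rw [sum_congr rfl fun k hk => by rw [hj k (mem_range.1 hk)]]
        have hlt' : (x j : ℝ) + 1 ≤ A m j := by exact_mod_cast hlt
        nlinarith [h.pos (m - 1 - j)]

theorem lexLe_of_tsum_eq (h : IsSupersolution A p δ w) (hfix : ∀ n, digitSum A w n = w n)
    (hlex : ∀ (n : ℤ) (j : ℕ), 1 ≤ j → lexLe (fun m => A n (m + j)) (A (n - j)))
    {n : ℤ} {b : ℕ → ℕ} (hb : ¬ EvZero b)
    (hsum : Summable fun j : ℕ => (b j : ℝ) * w (n - 1 - j))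
    (hval : ∑' j : ℕ, (b j : ℝ) * w (n - 1 - j) = w n) : lexLe b (A n) := by
  by_contra hnot
  obtain ⟨j, hj, hlt⟩ := lexLt_of_not_lexLe hnot
  have htail : ∑' k : ℕ, (A n (k + (j + 1)) : ℝ) * w (n - 1 - (k + (j + 1) : ℕ)) ≤
      w (n - 1 - j) := by
    refine Real.tsum_le_of_sum_range_le (fun k => h.term_nonneg n _) fun N => ?_
    have := h.sum_le_of_lexLe N (n - 1 - j) (fun i => A n (i + (j + 1))) fun k => by
      convert hlex n (k + (j + 1)) (by omega) using 2
      · simp only [add_assoc]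
      · push_cast; ring
    refine le_trans (le_of_eq (sum_congr rfl fun k _ => ?_)) this
    congr 2; push_cast; ring
  have hsplit := (h.summable n).sum_add_tsum_nat_add (j + 1)
  have hfixn : ∑' k : ℕ, (A n k : ℝ) * w (n - 1 - k) = w n := hfix n
  rw [hfixn, sum_range_succ, sum_congr rfl fun k hk => by rw [hj k (mem_range.1 hk)]] at hsplit
  obtain ⟨k, hk, hk0⟩ : ∃ k ≥ j + 1, b k ≠ 0 := by
    by_contra! hc
    exact hb ⟨j + 1, hc⟩
  have hbn : ∀ i, 0 ≤ (b i : ℝ) * w (n - 1 - i) := fun i =>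
    mul_nonneg (Nat.cast_nonneg _) (h.pos _).le
  have h1 := hsum.sum_le_tsum (range (k + 1)) fun i _ => hbn i
  rw [hval, sum_range_succ] at h1
  have h2 : ∑ i ∈ range (j + 1), (b i : ℝ) * w (n - 1 - i) ≤
      ∑ i ∈ range k, (b i : ℝ) * w (n - 1 - i) :=
    sum_le_sum_of_subset_of_nonneg (range_mono hk) fun i _ _ => hbn i
  rw [sum_range_succ] at h2
  have h3 : 0 < (b k : ℝ) * w (n - 1 - k) :=
    mul_pos (by exact_mod_cast Nat.pos_of_ne_zero hk0) (h.pos _)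
  have h4 : (A n j : ℝ) + 1 ≤ b j := by exact_mod_cast hlt
  nlinarith [h.pos (n - 1 - j)]

end IsSupersolution

theorem prod_eq_div {B w : ℤ → ℝ} (hw : ∀ n, 0 < w n) (hB : ∀ n, w (n + 1) = B n * w n)
    (n : ℤ) (k : ℕ) : ∏ i ∈ range k, B (n - 1 - i) = w n / w (n - k) := by
  induction k with
  | zero => simp [(hw n).ne']
  | succ k ih =>
    have h1 := hB (n - 1 - k)
    have e1 : n - 1 - (k : ℤ) + 1 = n - k := by ring
    have e2 : n - ((k + 1 : ℕ) : ℤ) = n - 1 - k := by push_cast; ring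
    rw [e1] at h1
    have := (hw (n - k)).ne'
    have := (hw (n - 1 - k)).ne'
    rw [prod_range_succ, ih, e2, div_mul_eq_mul_div, div_eq_div_iff (by assumption) (by assumption),
      h1]
    ring

theorem valS_term_eq {B w : ℤ → ℝ} (hw : ∀ n, 0 < w n) (hB : ∀ n, w (n + 1) = B n * w n)
    (n : ℤ) (b : ℕ → ℕ) (j : ℕ) :
    (b j : ℝ) / ∏ i ∈ range (j + 1), B (n - 1 - i) = (b j : ℝ) * w (n - 1 - j) / w n := by
  rw [prod_eq_div hw hB, div_div_eq_mul_div]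
  congr 3; push_cast; ring

theorem hasSum_of_valS_eq_one {B w : ℤ → ℝ} (hw : ∀ n, 0 < w n)
    (hB : ∀ n, w (n + 1) = B n * w n) {n : ℤ} {b : ℕ → ℕ} (hb : valS B n b = 1) :
    HasSum (fun j : ℕ => (b j : ℝ) * w (n - 1 - j)) (w n) := by
  have hs : Summable fun j : ℕ => (b j : ℝ) / ∏ i ∈ range (j + 1), B (n - 1 - i) := by
    by_contra hs
    have := tsum_eq_zero_of_not_summable hs
    unfold valS at hb
    linarith
  have h1 := hs.hasSum
  change HasSum _ (valS B n b) at h1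
  rw [hb] at h1
  simp_rw [valS_term_eq hw hB] at h1
  have h2 := h1.mul_right (w n)
  simpa [div_mul_cancel₀ _ (hw n).ne'] using h2

theorem valS_eq_tsum_div {B w : ℤ → ℝ} (hw : ∀ n, 0 < w n) (hB : ∀ n, w (n + 1) = B n * w n)
    (n : ℤ) (b : ℕ → ℕ) : valS B n b = (∑' j : ℕ, (b j : ℝ) * w (n - 1 - j)) / w n := by
  unfold valS
  simp_rw [valS_term_eq hw hB]
  exact tsum_div_const

theorem exists_weights {B : ℤ → ℝ} (hB : ∀ n, 0 < B n) :
    ∃ w : ℤ → ℝ, (∀ n, 0 < w n) ∧ ∀ n, w (n + 1) = B n * w n := by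
  refine ⟨fun n => (∏ i ∈ range n.toNat, B i) / ∏ i ∈ range (-n).toNat, B (-1 - i),
    fun n => div_pos (prod_pos fun i _ => hB _) (prod_pos fun i _ => hB _), fun n => ?_⟩
  rcases le_or_gt 0 n with hn | hn
  · lift n to ℕ using hn
    have e1 : ((n : ℤ) + 1).toNat = n + 1 := by omega
    have e2 : (-((n : ℤ) + 1)).toNat = 0 := by omega
    have e3 : (-(n : ℤ)).toNat = 0 := by omega
    simp only [e1, e2, e3, Int.toNat_natCast, prod_range_succ, range_zero, prod_empty]
    ring
  · obtain ⟨k, rfl⟩ : ∃ k : ℕ, n = -1 - k := ⟨(-1 - n).toNat, by omega⟩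
    have e1 : (-1 - (k : ℤ) + 1).toNat = 0 := by omega
    have e2 : (-(-1 - (k : ℤ) + 1)).toNat = k := by omega
    have e3 : (-(-1 - (k : ℤ))).toNat = k + 1 := by omega
    have e4 : (-1 - (k : ℤ)).toNat = 0 := by omega
    simp only [e1, e2, e3, e4, prod_range_succ, range_zero, prod_empty]
    have h1 := (hB (-1 - k)).ne'
    have h2 : (∏ i ∈ range k, B (-1 - i)) ≠ 0 := (prod_pos fun i _ => hB _).ne'
    field_simp

theorem exists_shift_factor {B w : ℤ → ℝ} {p : ℕ} (hw : ∀ n, 0 < w n)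
    (hB : ∀ n, w (n + 1) = B n * w n) (hB0 : ∀ n, 0 < B n) (hper : ∀ n, B (n + p) = B n) (n : ℤ) :
    w (n + p) = w p / w 0 * w n := by
  have hstep : ∀ m, w (m + 1 + p) = w p / w 0 * w (m + 1) ↔ w (m + p) = w p / w 0 * w m := by
    intro m
    rw [add_right_comm, hB, hB, hper, mul_left_comm]
    exact mul_right_inj' (hB0 m).ne'
  induction n using Int.induction_on with
  | zero => rw [zero_add, div_mul_cancel₀ _ (hw 0).ne']
  | succ k ih => exact (hstep k).2 ih
  | pred k ih => exact (hstep _).1 (by rwa [sub_add_cancel])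

/-- Uniqueness of the alternate base, when the period factors are compared. -/
theorem eq_of_valS_eq_one_of_le {A : ℤ → ℕ → ℕ} {p : ℕ} (hp : 1 ≤ p) (h0 : ∀ n, 1 ≤ A n 0)
    {B B' w w' : ℤ → ℝ} (hw : ∀ n, 0 < w n) (hw' : ∀ n, 0 < w' n)
    (hB : ∀ n, w (n + 1) = B n * w n) (hB' : ∀ n, w' (n + 1) = B' n * w' n)
    (hper : ∀ n, B (n + p) = B n) (hper' : ∀ n, B' (n + p) = B' n)
    (hval : ∀ n, valS B n (A n) = 1) (hval' : ∀ n, valS B' n (A n) = 1)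
    {δ δ' : ℝ} (hδ : ∀ n, w (n + p) = δ * w n) (hδ' : ∀ n, w' (n + p) = δ' * w' n)
    (hle : δ ≤ δ') : B = B' := by
  have hδ0 : 0 < δ := pos_of_mul_pos_left (by rw [← hδ 0]; exact hw _) (hw 0).le
  obtain ⟨n₀, hn₀, hmax⟩ := (range p).exists_max_image (fun n : ℕ => w' n / w n)
    ⟨0, mem_range.2 hp⟩
  set R := w' n₀ / w n₀ with hR
  have hstep : ∀ n, w' (n + p) ≤ R * w (n + p) → w' n ≤ R * w n := by
    intro n hn
    rw [hδ, hδ'] at hn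
    have h1 : δ * w' n ≤ δ' * w' n := mul_le_mul_of_nonneg_right hle (hw' n).le
    refine le_of_mul_le_mul_left ?_ hδ0
    linarith
  have hbound : ∀ n : ℤ, n < p → w' n ≤ R * w n := by
    have hk : ∀ k : ℕ, ∀ n : ℤ, 0 ≤ n + k * p → n < p → w' n ≤ R * w n := by
      intro k
      induction k with
      | zero =>
        intro n h1 h2
        lift n to ℕ using by simpa using h1
        rw [← div_le_iff₀ (hw _)]
        exact hmax n (mem_range.2 (by exact_mod_cast h2))
      | succ k ih =>
        intro n h1 h2
        rcases le_or_gt 0 n with hn | hn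
        · exact ih n (by positivity) h2
        · exact hstep n (ih (n + p) (by push_cast at h1; linarith) (by linarith))
    intro n hn
    have hp' : (1 : ℤ) ≤ p := by exact_mod_cast hp
    exact hk (-n).toNat n (by nlinarith [Int.self_le_toNat (-n), Int.natCast_nonneg (-n).toNat]) hn
  have hn₀p : (n₀ : ℤ) < p := by exact_mod_cast mem_range.1 hn₀
  have hdown : ∀ n : ℤ, n < p → w' n = R * w n → w' (n - 1) = R * w (n - 1) := by
    intro n hn heq
    refine (hbound _ (by omega)).antisymm ?_
    by_contra! hlt
    have s1 := (hasSum_of_valS_eq_one hw hB (hval n)).mul_left R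
    have s2 := hasSum_of_valS_eq_one hw' hB' (hval' n)
    have : w' n < R * w n := by
      refine hasSum_lt (i := 0) (fun j => ?_) ?_ s2 s1
      · have := hbound (n - 1 - j) (by omega)
        simp only
        rw [mul_left_comm]
        exact mul_le_mul_of_nonneg_left this (Nat.cast_nonneg _)
      · have h2 : (0 : ℝ) < A n 0 := by exact_mod_cast h0 n
        simp only [Nat.cast_zero, sub_zero]
        rw [mul_left_comm]
        exact mul_lt_mul_of_pos_left hlt h2
    exact this.ne heq
  have hall : ∀ l : ℕ, w' (n₀ - l) = R * w (n₀ - l) := by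
    intro l
    induction l with
    | zero => simp [hR, div_mul_cancel₀ _ (hw _).ne']
    | succ l ih =>
      have := hdown (n₀ - l) (by omega) ih
      have e : (n₀ : ℤ) - ((l + 1 : ℕ) : ℤ) = n₀ - l - 1 := by push_cast; ring
      rwa [e]
  funext n
  refine forall_int_of_period (P := fun n => B n = B' n) hp (fun n => by rw [hper, hper'])
    (n₀ - p) (fun l hl => ?_) n
  obtain ⟨k, rfl⟩ : ∃ k, p = l + 1 + k := ⟨p - (l + 1), by omega⟩
  have h1 := hall (k + 1)
  have h2 := hall k
  have e1 : (n₀ : ℤ) - ((l + 1 + k : ℕ) : ℤ) + l = n₀ - ((k + 1 : ℕ) : ℤ) := by push_cast; ring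
  have e2 : (n₀ : ℤ) - k = n₀ - ((k + 1 : ℕ) : ℤ) + 1 := by push_cast; ring
  rw [e1]
  rw [e2, hB, hB', h1] at h2
  have h3 : R * w (n₀ - ((k + 1 : ℕ) : ℤ)) ≠ 0 := by rw [← h1]; exact (hw' _).ne'
  refine mul_right_cancel₀ h3 ?_
  rw [h2]; ring

/-- The alternate base is determined by expansions of `1` with positive leading digits. -/
theorem eq_of_valS_eq_one {A : ℤ → ℕ → ℕ} {p : ℕ} (hp : 1 ≤ p) (h0 : ∀ n, 1 ≤ A n 0)
    {B B' : ℤ → ℝ} (hB : ∀ n, 0 < B n) (hB' : ∀ n, 0 < B' n)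
    (hper : ∀ n, B (n + p) = B n) (hper' : ∀ n, B' (n + p) = B' n)
    (hval : ∀ n, valS B n (A n) = 1) (hval' : ∀ n, valS B' n (A n) = 1) : B = B' := by
  obtain ⟨w, hw, hwB⟩ := exists_weights hB
  obtain ⟨w', hw', hwB'⟩ := exists_weights hB'
  have hδ := exists_shift_factor hw hwB hB hper
  have hδ' := exists_shift_factor hw' hwB' hB' hper'
  rcases le_total (w p / w 0) (w' p / w' 0) with hle | hle
  · exact eq_of_valS_eq_one_of_le hp h0 hw hw' hwB hwB' hper hper' hval hval' hδ hδ' hle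
  · exact (eq_of_valS_eq_one_of_le hp h0 hw' hw hwB' hwB hper' hper hval' hval hδ' hδ hle).symm

theorem valS_congr_base {B B' : ℤ → ℝ} {m n : ℤ} (h : ∀ k, B (m - k) = B' (n - k)) (b : ℕ → ℕ) :
    valS B m b = valS B' n b := by
  unfold valS
  refine tsum_congr fun j => ?_
  congr 1
  refine prod_congr rfl fun i _ => ?_
  rw [sub_sub, sub_sub, h]

theorem stmt18 (p : ℕ) (hp : 1 ≤ p)
    (a : ℕ → ℕ → ℕ)  -- `a i j` is the digit `a_{i,j+1}`
    (ha1 : ∀ i < p, 1 ≤ a i 0)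
    (hnz : ∀ i < p, ¬ EvZero (a i))
    (hcond : ∀ i < p, ∀ j : ℕ, 1 ≤ j →
      lexLe (fun m => a i (m + j)) (a ((((i : ℤ) - j) % (p : ℤ)).toNat))) :
    ∃ β : ℤ → ℝ,
      ((∀ n, 1 < β n) ∧ (∀ n, β (n + p) = β n) ∧
        (∀ i < p, IsQuasiGreedyOne β i (a i))) ∧
      (((∀ i < p, UltPer (a i)) ∨ (∀ i < p, 2 ≤ a i 0)) →
        ∀ β' : ℤ → ℝ,
          ((∀ n, 1 < β' n) ∧ (∀ n, β' (n + p) = β' n) ∧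
            (∀ i < p, IsQuasiGreedyOne β' i (a i))) → β' = β) := by
  have hp' : (0 : ℤ) < p := by exact_mod_cast hp
  set A : ℤ → ℕ → ℕ := fun n => a (n % (p : ℤ)).toNat with hAdef
  have hlt : ∀ n : ℤ, (n % (p : ℤ)).toNat < p := fun n => by
    have := Int.emod_lt_of_pos n hp'
    omega
  have hcast : ∀ n : ℤ, (((n % (p : ℤ)).toNat : ℕ) : ℤ) = n % p := fun n =>
    Int.toNat_of_nonneg (Int.emod_nonneg _ hp'.ne')
  have hAi : ∀ i < p, A i = a i := fun i hi => by
    simp only [hAdef]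
    rw [Int.emod_eq_of_lt (by positivity) (by exact_mod_cast hi), Int.toNat_natCast]
  have hA : ∀ n, A (n + p) = A n := fun n => by simp only [hAdef, Int.add_emod_right]
  have h0 : ∀ n, 1 ≤ A n 0 := fun n => ha1 _ (hlt n)
  have hAnz : ∀ n, ¬ EvZero (A n) := fun n => hnz _ (hlt n)
  have hlex : ∀ (n : ℤ) (j : ℕ), 1 ≤ j → lexLe (fun m => A n (m + j)) (A (n - j)) := by
    intro n j hj
    have := hcond _ (hlt n) j hj
    rwa [hcast, Int.emod_sub_emod] at this
  have hD : ∀ n j, A n j ≤ ∑ i ∈ range p, a i 0 := by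
    intro n j
    have h1 : A n j ≤ A (n - j) 0 := by
      rcases Nat.eq_zero_or_pos j with rfl | hj
      · simp
      · simpa using (hlex n j hj).head_le
    exact h1.trans (single_le_sum (f := fun i => a i 0) (fun i _ => Nat.zero_le _)
      (mem_range.2 (hlt _)))
  obtain ⟨δ, w, h, hfix⟩ := exists_digitSum_eq hp hA h0 hAnz hD
  have hwβ : ∀ n, w (n + 1) = w (n + 1) / w n * w n := fun n =>
    (div_mul_cancel₀ _ (h.pos n).ne').symm
  have hper : ∀ n, w (n + p + 1) / w (n + p) = w (n + 1) / w n := fun n => by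
    rw [add_right_comm, h.shift, h.shift, mul_div_mul_left _ _ h.delta_pos.ne']
  have hgt : ∀ n, 1 < w (n + 1) / w n := fun n =>
    (one_lt_div (h.pos n)).2 (h.lt_succ h0 hAnz n)
  have hval : ∀ n, valS (fun n => w (n + 1) / w n) n (A n) = 1 := fun n => by
    rw [valS_eq_tsum_div h.pos hwβ]
    exact (congrArg (· / w n) (hfix n)).trans (div_self (h.pos n).ne')
  refine ⟨fun n => w (n + 1) / w n, ⟨hgt, hper, fun i hi => ?_⟩, ?_⟩
  · rw [← hAi i hi]
    refine ⟨hAnz i, hval i, fun b hb hb1 => ?_⟩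
    have := hasSum_of_valS_eq_one h.pos hwβ hb1
    exact h.lexLe_of_tsum_eq hfix hlex hb this.summable this.tsum_eq
  · rintro - β' ⟨hgt', hper', hq⟩
    refine eq_of_valS_eq_one (A := A) hp h0 (fun n => one_pos.trans (hgt' n))
      (fun n => one_pos.trans (hgt n)) hper' hper (fun n => ?_) hval
    refine forall_int_of_period (P := fun n => valS β' n (A n) = 1) hp (fun n => ?_) 0
      (fun l hl => ?_) n
    · rw [hA, valS_congr_base (n := n) fun k => by rw [add_sub_right_comm]; exact hper' _]
    · rw [zero_add, hAi l hl]
      exact (hq l hl).2.1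
end
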